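/- arXiv:2603.03889 — 2 statements merged into one kernel-verified Lean document; each statement's English description precedes it below -/
import Mathlib

section
/- Let x ∈ (0,1] have a Lüroth digit sequence that is not eventually periodic, and suppose liminf_{n→∞} ℓ_n(x)/n = α and limsup_{n→∞} ℓ_n(x)/n = β with 0 < β < 1. Then α ≤ β/(1+β). -/
open Filter MeasureTheory Set

/-- The Lüroth transformation on (0,1]. -/
noncomputable def lurothT (x : ℝ) : ℝ :=
  (⌊1/x⌋ : ℝ) * ((⌊1/x⌋ : ℝ) + 1) * (x - 1/((⌊1/x⌋ : ℝ) + 1))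

/-- The n-th Lüroth digit (n ≥ 1): d₁(x) = ⌊1/x⌋ + 1, dₙ(x) = d₁(T^[n-1] x). -/
noncomputable def lurothD (n : ℕ) (x : ℝ) : ℕ :=
  (⌊1 / (lurothT^[n-1] x)⌋ + 1).toNat

/-- The n-th maximal run-length function. -/
noncomputable def runLen (n : ℕ) (x : ℝ) : ℕ :=
  sSup {k : ℕ | 1 ≤ k ∧ ∃ j : ℕ, j + k ≤ n ∧
    ∀ i : ℕ, 1 ≤ i → i ≤ k → lurothD (j + i) x = lurothD (j + 1) x}

/-- The level set E(α,β). -/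
noncomputable def Eab (a b : ℝ) : Set ℝ :=
  {x | x ∈ Set.Ioc (0:ℝ) 1 ∧
    Filter.liminf (fun n : ℕ => (runLen n x : ℝ) / n) Filter.atTop = a ∧
    Filter.limsup (fun n : ℕ => (runLen n x : ℝ) / n) Filter.atTop = b}

/-- The series ∑_{t=2}^∞ (1/(2^u t(t-1)))^s. -/
noncomputable def lurothF (u s : ℝ) : ℝ :=
  ∑' t : ℕ, (1 / (2 ^ u * ((t : ℝ) + 2) * ((t : ℝ) + 1))) ^ s

/-- The Lüroth digit sequence of x is eventually periodic. -/
def LurothEventuallyPeriodic (x : ℝ) : Prop :=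
  ∃ j : ℕ, ∃ k : ℕ, 1 ≤ k ∧ ∀ n : ℕ, j < n → lurothD (n + k) x = lurothD n x

theorem le_runLen {n j k : ℕ} {x : ℝ} (hk : 1 ≤ k) (hjk : j + k ≤ n)
    (h : ∀ i : ℕ, 1 ≤ i → i ≤ k → lurothD (j + i) x = lurothD (j + 1) x) :
    k ≤ runLen n x :=
  le_csSup ⟨n, fun _ ⟨_, _, hm, _⟩ => by omega⟩ ⟨hk, j, hjk, h⟩

theorem runLen_le (n : ℕ) (x : ℝ) : runLen n x ≤ n :=
  csSup_le' fun _ ⟨_, _, hm, _⟩ => by omega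

/-- If the digit changes right after position `n`, then no longer run can be completed
during the next `runLen n x` digits. -/
theorem runLen_add_runLen_le {n : ℕ} {x : ℝ}
    (hne : lurothD (n + 1) x ≠ lurothD n x) :
    runLen (n + runLen n x) x ≤ runLen n x := by
  refine csSup_le' ?_
  rintro k ⟨hk, j, hjk, h⟩
  rcases le_or_gt n j with hj | hj
  · omega
  rcases le_or_gt (j + k) n with hn' | hn'
  · exact le_runLen hk hn' h
  · have h1 := h (n - j) (by omega) (by omega)
    have h2 := h (n + 1 - j) (by omega) (by omega)
    rw [show j + (n - j) = n by omega] at h1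
    rw [show j + (n + 1 - j) = n + 1 by omega] at h2
    exact absurd (h2.trans h1.symm) hne

theorem frequently_lurothD_succ_ne {x : ℝ} (hper : ¬ LurothEventuallyPeriodic x) :
    ∃ᶠ n in atTop, lurothD (n + 1) x ≠ lurothD n x := by
  refine frequently_atTop.2 fun N => ?_
  by_contra! h
  exact hper ⟨N, 1, le_rfl, fun n hn => h n hn.le⟩

theorem runLen_div_nonneg (n : ℕ) (x : ℝ) : 0 ≤ (runLen n x : ℝ) / n := by positivity

theorem runLen_div_le_one (n : ℕ) (x : ℝ) : (runLen n x : ℝ) / n ≤ 1 :=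
  div_le_one_of_le₀ (by exact_mod_cast runLen_le n x) (by positivity)

theorem liminf_runLen_div_le {x b : ℝ} (hper : ¬ LurothEventuallyPeriodic x) (hb0 : 0 < b)
    (hb : limsup (fun n : ℕ => (runLen n x : ℝ) / n) atTop < b) :
    liminf (fun n : ℕ => (runLen n x : ℝ) / n) atTop ≤ b / (1 + b) := by
  have hev : ∀ᶠ n : ℕ in atTop, (runLen n x : ℝ) / n < b :=
    eventually_lt_of_limsup_lt hb
      (isBoundedUnder_of ⟨1, fun n => runLen_div_le_one n x⟩)
  refine liminf_le_of_frequently_le ?_ (isBoundedUnder_of ⟨0, fun n => runLen_div_nonneg n x⟩)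
  refine frequently_atTop.2 fun N => ?_
  obtain ⟨n, hne, hlt, hn⟩ := ((frequently_lurothD_succ_ne hper).and_eventually
    (hev.and (eventually_ge_atTop (max N 1)))).exists
  have hn1 : 1 ≤ n := (le_max_right _ _).trans hn
  refine ⟨n + runLen n x, ((le_max_left _ _).trans hn).trans (Nat.le_add_right _ _), ?_⟩
  have hle : (runLen (n + runLen n x) x : ℝ) ≤ runLen n x := by
    exact_mod_cast runLen_add_runLen_le hne
  have hnpos : (0 : ℝ) < n := by exact_mod_cast hn1
  have hlt' : (runLen n x : ℝ) < b * n := (div_lt_iff₀ hnpos).1 hlt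
  have hL : (0 : ℝ) ≤ runLen n x := Nat.cast_nonneg _
  push_cast
  rw [div_le_div_iff₀ (by positivity) (by positivity)]
  nlinarith [mul_le_mul_of_nonneg_right hle (by positivity : (0 : ℝ) ≤ 1 + b)]

/-- For non-eventually-periodic x with liminf ℓₙ/n = α, limsup ℓₙ/n = β and 0 < β < 1,
    we have α ≤ β/(1+β). -/
theorem luroth_alpha_le_critical (x : ℝ) (hx : x ∈ Set.Ioc (0:ℝ) 1)
    (hper : ¬ LurothEventuallyPeriodic x) (α β : ℝ)
    (hliminf : Filter.liminf (fun n : ℕ => (runLen n x : ℝ) / n) Filter.atTop = α)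
    (hlimsup : Filter.limsup (fun n : ℕ => (runLen n x : ℝ) / n) Filter.atTop = β)
    (hβ0 : 0 < β) (hβ1 : β < 1) :
    α ≤ β / (1 + β) := by
  have key : ∀ b, β < b → α * (1 + b) ≤ b := fun b hb =>
    (le_div_iff₀ (by linarith)).1
      (hliminf ▸ liminf_runLen_div_le hper (hβ0.trans hb) (hlimsup ▸ hb))
  have hα : 0 < 1 - α := by nlinarith [key 1 hβ1]
  have h : α / (1 - α) ≤ β := le_of_forall_gt_imp_ge_of_dense fun b hb =>
    (div_le_iff₀ hα).2 (by linarith [key b hb])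
  rw [div_le_iff₀ hα] at h
  rw [le_div_iff₀ (by linarith)]
  linarith
end

section
/- Let 𝒥 = {j_1 < j_2 < ⋯} be an infinite set of positive integers with density zero, i.e. lim_{n→∞} #{i ≤ n : i ∈ 𝒥}/n = 0, and let (d_i)_{i≥1} be a sequence of integers with 2 ≤ d_i ≤ M for some integer M ≥ 2. Then the set E(𝒥,(d_i)) = {x ∈ (0,1] : d_i(x) = d_i for all i ∈ 𝒥} has Hausdorff dimension 1. -/
open Filter MeasureTheory Set

/-- The inverse branch of the Lüroth map attached to the digit `k`. -/
noncomputable def lurothBranch (k : ℕ) (z : ℝ) : ℝ := 1 / k + z / (k * (k - 1))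

lemma lurothBranch_floor {k : ℕ} (hk : 2 ≤ k) {z : ℝ} (hz : z ∈ Ioc (0 : ℝ) 1) :
    ⌊1 / lurothBranch k z⌋ = (k : ℤ) - 1 := by
  have hk' : (2 : ℝ) ≤ k := by exact_mod_cast hk
  have h1 : (0 : ℝ) < k - 1 := by linarith
  have e : lurothBranch k z = ((k - 1) + z) / (k * (k - 1)) := by
    unfold lurothBranch; field_simp
  obtain ⟨z0, z1⟩ := hz
  rw [Int.floor_eq_iff, e, one_div_div]
  push_cast
  constructor
  · rw [le_div_iff₀ (by linarith)]; nlinarith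
  · rw [div_lt_iff₀ (by linarith)]; nlinarith

lemma lurothT_lurothBranch {k : ℕ} (hk : 2 ≤ k) {z : ℝ} (hz : z ∈ Ioc (0 : ℝ) 1) :
    lurothT (lurothBranch k z) = z := by
  have hk' : (2 : ℝ) ≤ k := by exact_mod_cast hk
  have h1 : (k : ℝ) - 1 ≠ 0 := by linarith
  unfold lurothT
  rw [lurothBranch_floor hk hz]
  unfold lurothBranch
  push_cast
  simp only [sub_add_cancel]
  field_simp
  ring

lemma exists_lurothBranch_eq {y : ℝ} (hy : y ∈ Ioc (0 : ℝ) 1) :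
    2 ≤ lurothD 1 y ∧ lurothT y ∈ Ioc (0 : ℝ) 1 ∧ y = lurothBranch (lurothD 1 y) (lurothT y) := by
  obtain ⟨y0, y1⟩ := hy
  have hfl : (1 : ℤ) ≤ ⌊1 / y⌋ := by
    rw [Int.le_floor]; push_cast; rw [le_div_iff₀ y0]; linarith
  obtain ⟨k, hk⟩ : ∃ k : ℕ, ⌊1 / y⌋ = k := Int.eq_ofNat_of_zero_le (by omega)
  have hk1 : 1 ≤ k := by omega
  have hk1' : (1 : ℝ) ≤ k := by exact_mod_cast hk1
  have hD : lurothD 1 y = k + 1 := by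
    simp only [lurothD, Nat.sub_self, Function.iterate_zero, id_eq, hk]; omega
  have hle : (k : ℝ) * y ≤ 1 := by
    have := Int.floor_le (1 / y); rw [hk, le_div_iff₀ y0] at this; exact_mod_cast this
  have hlt : 1 < ((k : ℝ) + 1) * y := by
    have := Int.lt_floor_add_one (1 / y); rw [hk, div_lt_iff₀ y0] at this; exact_mod_cast this
  have hT : lurothT y = k * ((k + 1) * y - 1) := by
    simp only [lurothT, hk, Int.cast_natCast]; field_simp
  rw [hD, hT]
  refine ⟨by omega, ⟨by apply mul_pos <;> linarith, by nlinarith⟩, ?_⟩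
  have hk0 : (k : ℝ) ≠ 0 := by linarith
  unfold lurothBranch
  push_cast
  simp only [add_sub_cancel_right]
  field_simp
  ring

/-- The contraction ratio of the branch attached to the digit `k`. -/
noncomputable def lurothRatio (k : ℕ) : ℝ := 1 / (k * (k - 1))

lemma lurothRatio_pos {k : ℕ} (hk : 2 ≤ k) : 0 < lurothRatio k := by
  have hk' : (2 : ℝ) ≤ k := by exact_mod_cast hk
  exact one_div_pos.2 (mul_pos (by linarith) (by linarith))

lemma lurothRatio_le_half {k : ℕ} (hk : 2 ≤ k) : lurothRatio k ≤ 1 / 2 := by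
  have hk' : (2 : ℝ) ≤ k := by exact_mod_cast hk
  exact one_div_le_one_div_of_le (by norm_num) (by nlinarith)

lemma lurothBranch_eq (k : ℕ) (z : ℝ) : lurothBranch k z = 1 / k + lurothRatio k * z := by
  unfold lurothBranch lurothRatio; ring

lemma one_le_mul_lurothRatio {k M : ℕ} (hk : 2 ≤ k) (hkM : k ≤ M) :
    1 ≤ (M : ℝ) ^ 2 * lurothRatio k := by
  have hk' : (2 : ℝ) ≤ k := by exact_mod_cast hk
  have hM : (k : ℝ) ≤ M := by exact_mod_cast hkM
  unfold lurothRatio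
  rw [mul_one_div, le_div_iff₀ (mul_pos (by linarith) (by linarith))]
  nlinarith

/-- The general term of the Lüroth series with digits `a`. -/
noncomputable def lurothTerm (a : ℕ → ℕ) (k : ℕ) : ℝ :=
  (∏ i ∈ Finset.range k, lurothRatio (a i)) * (1 / a k)

lemma prod_lurothRatio_le {a : ℕ → ℕ} (ha : ∀ i, 2 ≤ a i) (n : ℕ) :
    ∏ i ∈ Finset.range n, lurothRatio (a i) ≤ (1 / 2) ^ n := by
  simpa using Finset.prod_le_prod (s := Finset.range n) (g := fun _ => (1 / 2 : ℝ))
    (fun i _ => (lurothRatio_pos (ha i)).le) fun i _ => lurothRatio_le_half (ha i)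

lemma prod_lurothRatio_pos {a : ℕ → ℕ} (ha : ∀ i, 2 ≤ a i) (n : ℕ) :
    0 < ∏ i ∈ Finset.range n, lurothRatio (a i) :=
  Finset.prod_pos fun i _ => lurothRatio_pos (ha i)

lemma lurothTerm_pos {a : ℕ → ℕ} (ha : ∀ i, 2 ≤ a i) (k : ℕ) : 0 < lurothTerm a k := by
  have : (2 : ℝ) ≤ a k := by exact_mod_cast ha k
  exact mul_pos (prod_lurothRatio_pos ha k) (one_div_pos.2 (by linarith))

lemma lurothTerm_le {a : ℕ → ℕ} (ha : ∀ i, 2 ≤ a i) (k : ℕ) :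
    lurothTerm a k ≤ 1 / 2 / 2 ^ k := by
  have h2 : (2 : ℝ) ≤ a k := by exact_mod_cast ha k
  have : (1 : ℝ) / a k ≤ 1 / 2 := one_div_le_one_div_of_le (by norm_num) h2
  calc lurothTerm a k ≤ (1 / 2) ^ k * (1 / 2) :=
        mul_le_mul (prod_lurothRatio_le ha k) this (by positivity) (by positivity)
    _ = 1 / 2 / 2 ^ k := by rw [one_div_pow]; ring

lemma summable_lurothTerm {a : ℕ → ℕ} (ha : ∀ i, 2 ≤ a i) : Summable (lurothTerm a) :=
  Summable.of_nonneg_of_le (fun k => (lurothTerm_pos ha k).le) (lurothTerm_le ha)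
    (hasSum_geometric_two' 1).summable

/-- The point of `(0, 1]` with Lüroth digits `a`. -/
noncomputable def lurothSeries (a : ℕ → ℕ) : ℝ := ∑' k, lurothTerm a k

lemma lurothSeries_mem {a : ℕ → ℕ} (ha : ∀ i, 2 ≤ a i) : lurothSeries a ∈ Ioc (0 : ℝ) 1 := by
  refine ⟨(summable_lurothTerm ha).tsum_pos (fun k => (lurothTerm_pos ha k).le) 0
    (lurothTerm_pos ha 0), ?_⟩
  have h := hasSum_geometric_two' (1 : ℝ)
  have := (summable_lurothTerm ha).tsum_le_tsum (lurothTerm_le ha) h.summable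
  rw [h.tsum_eq] at this
  unfold lurothSeries
  linarith

lemma lurothSeries_eq {a : ℕ → ℕ} (ha : ∀ i, 2 ≤ a i) :
    lurothSeries a = lurothBranch (a 0) (lurothSeries fun k => a (k + 1)) := by
  rw [lurothBranch_eq, lurothSeries, (summable_lurothTerm ha).tsum_eq_zero_add, lurothSeries,
    ← tsum_mul_left]
  congr 1
  · simp [lurothTerm]
  · refine tsum_congr fun k => ?_
    simp only [lurothTerm, Finset.prod_range_succ']
    ring

lemma lurothT_iterate_lurothSeries {a : ℕ → ℕ} (ha : ∀ i, 2 ≤ a i) (n : ℕ) :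
    lurothT^[n] (lurothSeries a) = lurothSeries fun k => a (k + n) := by
  induction n with
  | zero => rfl
  | succ n ih =>
    rw [Function.iterate_succ_apply', ih, lurothSeries_eq fun i => ha (i + n),
      lurothT_lurothBranch (ha _) (lurothSeries_mem fun i => ha (i + 1 + n))]
    simp only [add_assoc, add_comm 1 n]

lemma lurothD_lurothSeries {a : ℕ → ℕ} (ha : ∀ i, 2 ≤ a i) (n : ℕ) :
    lurothD (n + 1) (lurothSeries a) = a n := by
  rw [lurothD, Nat.add_sub_cancel, lurothT_iterate_lurothSeries ha,
    lurothSeries_eq fun i => ha (i + n),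
    lurothBranch_floor (ha _) (lurothSeries_mem fun i => ha (i + 1 + n))]
  simp

/-- `X` and `Y` are the orbits of two points under the Lüroth map, the first with digits `a`, the
second with the digits that remain after those at positions in `J`, prescribed by `d`, are deleted
from `a`; during a deletion the second orbit waits. -/
structure LurothCoupling (J : Set ℕ) (d a : ℕ → ℕ) (X Y : ℕ → ℝ) : Prop where
  two_le : ∀ n, 2 ≤ a n
  digit : ∀ n, n + 1 ∈ J → a n = d (n + 1)
  memX : ∀ n, X n ∈ Ioc (0 : ℝ) 1
  memY : ∀ n, Y n ∈ Ioc (0 : ℝ) 1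
  stepX : ∀ n, X n = lurothBranch (a n) (X (n + 1))
  waitY : ∀ n, n + 1 ∈ J → Y n = Y (n + 1)
  stepY : ∀ n, n + 1 ∉ J → Y n = lurothBranch (a n) (Y (n + 1))

open Classical in
/-- The orbit of `y` under the Lüroth map, waiting at the times in `J`. -/
noncomputable def waitingOrbit (J : Set ℕ) (y : ℝ) : ℕ → ℝ
  | 0 => y
  | n + 1 => if n + 1 ∈ J then waitingOrbit J y n else lurothT (waitingOrbit J y n)

open Classical in
/-- The digits of `y`, with the digits `d` inserted at the positions in `J`. -/
noncomputable def insertDigits (J : Set ℕ) (d : ℕ → ℕ) (y : ℝ) (n : ℕ) : ℕ :=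
  if n + 1 ∈ J then d (n + 1) else lurothD 1 (waitingOrbit J y n)

lemma lurothCoupling_insertDigits (J : Set ℕ) {d : ℕ → ℕ} (hd : ∀ i, 2 ≤ d i) {y : ℝ}
    (hy : y ∈ Ioc (0 : ℝ) 1) :
    LurothCoupling J d (insertDigits J d y)
      (fun n => lurothSeries fun k => insertDigits J d y (k + n)) (waitingOrbit J y) := by
  have hY : ∀ n, waitingOrbit J y n ∈ Ioc (0 : ℝ) 1 := by
    intro n
    induction n with
    | zero => exact hy
    | succ n ih =>
      rw [waitingOrbit]
      split_ifs
      · exact ih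
      · exact (exists_lurothBranch_eq ih).2.1
  have h2 : ∀ n, 2 ≤ insertDigits J d y n := by
    intro n
    unfold insertDigits
    split_ifs
    · exact hd _
    · exact (exists_lurothBranch_eq (hY n)).1
  refine ⟨h2, fun n hn => by simp [insertDigits, hn], fun n => lurothSeries_mem fun k => h2 _, hY,
    fun n => ?_, fun n hn => by simp [waitingOrbit, hn], fun n hn => ?_⟩
  · rw [lurothSeries_eq fun k => h2 _]
    simp only [add_assoc, add_comm 1 n, zero_add]
  · rw [insertDigits, if_neg hn, waitingOrbit, if_neg hn]
    exact (exists_lurothBranch_eq (hY n)).2.2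

open Classical in
/-- The product of the contraction ratios of the first `n` digits at positions outside `J`. -/
noncomputable def freeProd (J : Set ℕ) (a : ℕ → ℕ) (n : ℕ) : ℝ :=
  ∏ i ∈ Finset.range n, if i + 1 ∈ J then 1 else lurothRatio (a i)

lemma freeProd_nonneg {J : Set ℕ} {a : ℕ → ℕ} (ha : ∀ i, 2 ≤ a i) (n : ℕ) :
    0 ≤ freeProd J a n := by
  refine Finset.prod_nonneg fun i _ => ?_
  split_ifs
  · exact zero_le_one
  · exact (lurothRatio_pos (ha i)).le

lemma ncard_inter_Icc_succ (J : Set ℕ) (n : ℕ) [Decidable (n + 1 ∈ J)] :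
    (J ∩ Icc 1 (n + 1)).ncard = (J ∩ Icc 1 n).ncard + if n + 1 ∈ J then 1 else 0 := by
  have hfin : (J ∩ Icc 1 n).Finite := (finite_Icc 1 n).inter_of_right J
  split_ifs with h
  · have hmem : n + 1 ∉ J ∩ Icc 1 n := by simp
    rw [← ncard_insert_of_notMem hmem hfin]
    congr 1
    ext i
    simp only [mem_inter_iff, mem_Icc, mem_insert_iff]
    constructor
    · rintro ⟨hi, h1, h2⟩
      by_cases e : i = n + 1
      · exact Or.inl e
      · exact Or.inr ⟨hi, h1, by omega⟩
    · rintro (rfl | ⟨hi, h1, h2⟩)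
      · exact ⟨h, by omega, le_rfl⟩
      · exact ⟨hi, h1, by omega⟩
  · rw [add_zero]
    congr 1
    ext i
    simp only [mem_inter_iff, mem_Icc]
    constructor
    · rintro ⟨hi, h1, h2⟩
      exact ⟨hi, h1, by
        have : i ≠ n + 1 := by rintro rfl; exact h hi
        omega⟩
    · rintro ⟨hi, h1, h2⟩
      exact ⟨hi, h1, by omega⟩

lemma freeProd_le {J : Set ℕ} {M : ℕ} {a : ℕ → ℕ} (ha : ∀ i, 2 ≤ a i)
    (haM : ∀ n, n + 1 ∈ J → a n ≤ M) (n : ℕ) :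
    freeProd J a n ≤
      ((M : ℝ) ^ 2) ^ (J ∩ Icc 1 n).ncard * ∏ i ∈ Finset.range n, lurothRatio (a i) := by
  classical
  induction n with
  | zero => simp [freeProd]
  | succ n ih =>
    rw [ncard_inter_Icc_succ, Finset.prod_range_succ, freeProd, Finset.prod_range_succ]
    change freeProd J a n * _ ≤ _
    split_ifs with h
    · have h1 := one_le_mul_lurothRatio (ha n) (haM n h)
      calc freeProd J a n * 1 ≤ _ := mul_le_mul ih h1 zero_le_one
            (mul_nonneg (by positivity) (prod_lurothRatio_pos ha n).le)
        _ = _ := by ring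
    · rw [add_zero, ← mul_assoc]
      exact mul_le_mul_of_nonneg_right ih (lurothRatio_pos (ha n)).le

lemma exists_pow_ncard_le {J : Set ℕ}
    (hdens : Tendsto (fun n : ℕ => ((J ∩ Icc 1 n).ncard : ℝ) / n) atTop (nhds 0))
    {A ρ : ℝ} (hA : 1 ≤ A) (hρ0 : 0 < ρ) (hρ : ρ < 1) :
    ∃ C : ℝ, 1 ≤ C ∧ ∀ n, A ^ (J ∩ Icc 1 n).ncard * ρ ^ n ≤ C := by
  obtain ⟨ε, hε0, hε⟩ : ∃ ε : ℝ, 0 < ε ∧ A ^ ε * ρ ≤ 1 := by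
    have hc : Tendsto (fun ε : ℝ => A ^ ε * ρ) (nhdsWithin 0 (Ioi 0)) (nhds (A ^ (0 : ℝ) * ρ)) :=
      (((Real.continuous_const_rpow (by positivity)).mul continuous_const).tendsto 0).mono_left
        nhdsWithin_le_nhds
    rw [Real.rpow_zero, one_mul] at hc
    obtain ⟨ε, h1, h2⟩ := ((hc.eventually_le_const hρ).and self_mem_nhdsWithin).exists
    exact ⟨ε, h2, h1⟩
  obtain ⟨m, hm⟩ := eventually_atTop.1 (hdens.eventually_le_const hε0)
  have hnn : ∀ n, 0 ≤ A ^ (J ∩ Icc 1 n).ncard * ρ ^ n := fun n => by positivity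
  refine ⟨1 + ∑ n ∈ Finset.range (m + 1), A ^ (J ∩ Icc 1 n).ncard * ρ ^ n,
    le_add_of_nonneg_right (Finset.sum_nonneg fun n _ => hnn n), fun n => ?_⟩
  by_cases hn : n < m + 1
  · exact (Finset.single_le_sum (fun i _ => hnn i) (Finset.mem_range.2 hn)).trans
      (le_add_of_nonneg_left zero_le_one)
  · refine le_trans ?_ (le_add_of_nonneg_right (Finset.sum_nonneg fun n _ => hnn n))
    have hn0 : (0 : ℝ) < n := by
      have : 0 < n := by omega
      exact_mod_cast this
    have h := hm n (by omega)
    rw [div_le_iff₀ hn0] at h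
    calc A ^ (J ∩ Icc 1 n).ncard * ρ ^ n ≤ (A ^ ε) ^ n * ρ ^ n := by
          gcongr
          rw [← Real.rpow_natCast, ← Real.rpow_natCast, ← Real.rpow_mul (by positivity)]
          exact Real.rpow_le_rpow_of_exponent_le hA h
      _ = (A ^ ε * ρ) ^ n := by rw [mul_pow]
      _ ≤ 1 := pow_le_one₀ (by positivity) hε

lemma exists_freeProd_le_rpow {J : Set ℕ}
    (hdens : Tendsto (fun n : ℕ => ((J ∩ Icc 1 n).ncard : ℝ) / n) atTop (nhds 0))
    {M : ℕ} (hM : 1 ≤ M) {s : ℝ} (hs : s < 1) :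
    ∃ C : ℝ, 1 ≤ C ∧ ∀ a : ℕ → ℕ, (∀ i, 2 ≤ a i) → (∀ n, n + 1 ∈ J → a n ≤ M) →
      ∀ n, freeProd J a n ≤ C * (∏ i ∈ Finset.range n, lurothRatio (a i)) ^ s := by
  have hM' : (1 : ℝ) ≤ M := by exact_mod_cast hM
  obtain ⟨C, hC1, hC⟩ := exists_pow_ncard_le hdens (A := (M : ℝ) ^ 2)
    (ρ := (1 / 2 : ℝ) ^ (1 - s)) (one_le_pow₀ hM') (by positivity)
    (Real.rpow_lt_one (by norm_num) (by norm_num) (by linarith))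
  refine ⟨C, hC1, fun a ha haM n => (freeProd_le ha haM n).trans ?_⟩
  set q := ∏ i ∈ Finset.range n, lurothRatio (a i) with hq
  have q0 : 0 < q := prod_lurothRatio_pos ha n
  have hsplit : q = q ^ (1 - s) * q ^ s := by rw [← Real.rpow_add q0]; simp
  have hq' : q ^ (1 - s) ≤ ((1 / 2 : ℝ) ^ (1 - s)) ^ n := by
    rw [← Real.rpow_natCast, ← Real.rpow_mul (by norm_num), mul_comm, Real.rpow_mul (by norm_num),
      Real.rpow_natCast]
    exact Real.rpow_le_rpow q0.le (prod_lurothRatio_le ha n) (by linarith)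
  calc ((M : ℝ) ^ 2) ^ (J ∩ Icc 1 n).ncard * q
      = ((M : ℝ) ^ 2) ^ (J ∩ Icc 1 n).ncard * q ^ (1 - s) * q ^ s := by
        rw [mul_assoc, ← hsplit]
    _ ≤ ((M : ℝ) ^ 2) ^ (J ∩ Icc 1 n).ncard * ((1 / 2 : ℝ) ^ (1 - s)) ^ n * q ^ s := by gcongr
    _ ≤ C * q ^ s := by gcongr; exact hC n

namespace LurothCoupling

variable {J : Set ℕ} {M : ℕ} {d a a' : ℕ → ℕ} {X Y X' Y' : ℕ → ℝ} {C s : ℝ}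

lemma Y_le_mul_X (h : LurothCoupling J d a X Y) (hM : 2 ≤ M) (hd : ∀ i, d i ≤ M) (n : ℕ) :
    Y n ≤ M * X n := by
  have hM' : (2 : ℝ) ≤ M := by exact_mod_cast hM
  have hr := lurothRatio_pos (h.two_le n)
  have ha : (2 : ℝ) ≤ a n := by exact_mod_cast h.two_le n
  have hX : 1 / (a n : ℝ) ≤ X n := by
    rw [h.stepX n, lurothBranch_eq]
    exact le_add_of_nonneg_right (mul_nonneg hr.le (h.memX _).1.le)
  by_cases hn : n + 1 ∈ J
  · have : (a n : ℝ) ≤ M := by rw [h.digit n hn]; exact_mod_cast hd _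
    calc Y n ≤ 1 := (h.memY n).2
      _ ≤ M * (1 / a n) := by rw [mul_one_div, le_div_iff₀ (by linarith)]; linarith
      _ ≤ M * X n := by gcongr
  · have hY : Y n ≤ 2 * (1 / a n) := by
      rw [h.stepY n hn, lurothBranch_eq, two_mul]
      refine add_le_add_right ?_ _
      calc lurothRatio (a n) * Y (n + 1) ≤ lurothRatio (a n) :=
            mul_le_of_le_one_right hr.le (h.memY _).2
        _ ≤ 1 / a n := one_div_le_one_div_of_le (by linarith) (by nlinarith)
    calc Y n ≤ 2 * (1 / a n) := hY
      _ ≤ M * X n := mul_le_mul hM' hX (by positivity) (by positivity)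

lemma tendsto_freeProd (h : LurothCoupling J d a X Y) (hs0 : 0 < s)
    (hC : ∀ n, freeProd J a n ≤ C * (∏ i ∈ Finset.range n, lurothRatio (a i)) ^ s) :
    Tendsto (freeProd J a) atTop (nhds 0) := by
  have hq : Tendsto (fun n => ∏ i ∈ Finset.range n, lurothRatio (a i)) atTop (nhds 0) :=
    squeeze_zero (fun n => (prod_lurothRatio_pos h.two_le n).le) (prod_lurothRatio_le h.two_le)
      (tendsto_pow_atTop_nhds_zero_of_lt_one (by norm_num) (by norm_num))
  have hr := (hq.rpow_const (Or.inr hs0.le)).const_mul C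
  rw [Real.zero_rpow hs0.ne', mul_zero] at hr
  exact squeeze_zero (freeProd_nonneg h.two_le) hC hr

lemma freeProd_mul_one_sub_le (h : LurothCoupling J d a X Y) (hs0 : 0 < s) (hs1 : s < 1)
    (hC0 : 1 ≤ C)
    (hC : ∀ n, freeProd J a n ≤ C * (∏ i ∈ Finset.range n, lurothRatio (a i)) ^ s) (n : ℕ) :
    freeProd J a n * (1 - Y n) ≤
      2 * C * ((∏ i ∈ Finset.range n, lurothRatio (a i)) * (1 - X n)) ^ s := by
  classical
  have hq : ∀ n, 0 < ∏ i ∈ Finset.range n, lurothRatio (a i) := prod_lurothRatio_pos h.two_le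
  have step : ∀ n, a n = 2 → freeProd J a n * (1 - Y n) = freeProd J a (n + 1) * (1 - Y (n + 1)) ∧
      (∏ i ∈ Finset.range n, lurothRatio (a i)) * (1 - X n) =
        (∏ i ∈ Finset.range (n + 1), lurothRatio (a i)) * (1 - X (n + 1)) := by
    intro n hn
    constructor
    · rw [freeProd, freeProd, Finset.prod_range_succ]
      split_ifs with hJ
      · rw [h.waitY n hJ, mul_one]
      · rw [h.stepY n hJ, lurothBranch_eq, hn, lurothRatio]
        push_cast
        ring
    · rw [h.stepX n, lurothBranch_eq, Finset.prod_range_succ, hn, lurothRatio]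
      push_cast
      ring
  have base : ∀ n, a n ≠ 2 → freeProd J a n * (1 - Y n) ≤
      2 * C * ((∏ i ∈ Finset.range n, lurothRatio (a i)) * (1 - X n)) ^ s := by
    intro n hn
    have h3 : 3 ≤ a n := by have := h.two_le n; omega
    have h3' : (3 : ℝ) ≤ a n := by exact_mod_cast h3
    have hX : X n ≤ 1 / 2 := by
      have hle : X n ≤ 1 / a n + lurothRatio (a n) := by
        rw [h.stepX n, lurothBranch_eq]
        exact add_le_add_right
          (mul_le_of_le_one_right (lurothRatio_pos (h.two_le n)).le (h.memX _).2) _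
      have h4 : 1 / (a n : ℝ) ≤ 1 / 3 := one_div_le_one_div_of_le (by norm_num) h3'
      have h5 : lurothRatio (a n) ≤ 1 / 6 := one_div_le_one_div_of_le (by norm_num) (by nlinarith)
      linarith
    have h12 : (1 / 2 : ℝ) ≤ (1 / 2) ^ s := by
      simpa using Real.rpow_le_rpow_of_exponent_ge (x := 1 / 2) (by norm_num) (by norm_num) hs1.le
    have hq0 := (hq n).le
    calc freeProd J a n * (1 - Y n) ≤ freeProd J a n :=
          mul_le_of_le_one_right (freeProd_nonneg h.two_le n) (by linarith [(h.memY n).1])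
      _ ≤ C * (∏ i ∈ Finset.range n, lurothRatio (a i)) ^ s := hC n
      _ = 2 * C * ((∏ i ∈ Finset.range n, lurothRatio (a i)) ^ s * (1 / 2)) := by ring
      _ ≤ 2 * C * ((∏ i ∈ Finset.range n, lurothRatio (a i)) ^ s * (1 - X n) ^ s) := by
          have : (1 / 2 : ℝ) ^ s ≤ (1 - X n) ^ s :=
            Real.rpow_le_rpow (by norm_num) (by linarith) hs0.le
          gcongr
          exact h12.trans this
      _ = _ := by rw [Real.mul_rpow hq0 (by linarith)]
  by_cases hall : ∃ k, a (n + k) ≠ 2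
  · obtain ⟨k, hk⟩ := hall
    induction k generalizing n with
    | zero => exact base n hk
    | succ k ih =>
      by_cases hn : a n = 2
      · rw [(step n hn).1, (step n hn).2]
        exact ih (n + 1) (by rwa [add_assoc, add_comm 1 k])
      · exact base n hn
  · push Not at hall
    have hk : ∀ k, freeProd J a n * (1 - Y n) = freeProd J a (n + k) * (1 - Y (n + k)) := by
      intro k
      induction k with
      | zero => rfl
      | succ k ih => rw [ih, (step _ (hall k)).1, add_assoc]
    have hlim := h.tendsto_freeProd hs0 hC
    have : freeProd J a n * (1 - Y n) ≤ 0 := by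
      refine ge_of_tendsto (hlim.comp (tendsto_add_atTop_nat n)) (Eventually.of_forall fun k => ?_)
      rw [hk k, add_comm n k]
      exact mul_le_of_le_one_right (freeProd_nonneg h.two_le _) (by linarith [(h.memY (k + n)).1])
    exact this.trans (mul_nonneg (by linarith)
      (Real.rpow_nonneg (mul_nonneg (hq n).le (by linarith [(h.memX n).2])) s))

lemma sub_X_eq (h : LurothCoupling J d a X Y) (h' : LurothCoupling J d a' X' Y') {n : ℕ}
    (haa : ∀ i < n, a i = a' i) :
    X' 0 - X 0 = (∏ i ∈ Finset.range n, lurothRatio (a i)) * (X' n - X n) := by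
  induction n with
  | zero => simp
  | succ n ih =>
    rw [ih fun i hi => haa i (by omega), h.stepX n, h'.stepX n, lurothBranch_eq, lurothBranch_eq,
      Finset.prod_range_succ, ← haa n (by omega)]
    ring

lemma sub_Y_eq (h : LurothCoupling J d a X Y) (h' : LurothCoupling J d a' X' Y') {n : ℕ}
    (haa : ∀ i < n, a i = a' i) :
    Y' 0 - Y 0 = freeProd J a n * (Y' n - Y n) := by
  classical
  induction n with
  | zero => simp [freeProd]
  | succ n ih =>
    rw [ih fun i hi => haa i (by omega), freeProd, freeProd, Finset.prod_range_succ]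
    split_ifs with hJ
    · rw [h.waitY n hJ, h'.waitY n hJ, mul_one]
    · rw [h.stepY n hJ, h'.stepY n hJ, lurothBranch_eq, lurothBranch_eq, ← haa n (by omega)]
      ring

lemma exists_first_ne (h : LurothCoupling J d a X Y) (h' : LurothCoupling J d a' X' Y')
    (hs0 : 0 < s)
    (hC : ∀ n, freeProd J a n ≤ C * (∏ i ∈ Finset.range n, lurothRatio (a i)) ^ s)
    (hY : Y 0 < Y' 0) : ∃ n, n + 1 ∉ J ∧ a' n < a n ∧ ∀ i < n, a i = a' i := by
  classical
  have hex : ∃ n, a n ≠ a' n := by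
    by_contra! hc
    have : Y' 0 - Y 0 ≤ 0 := by
      refine ge_of_tendsto (h.tendsto_freeProd hs0 hC) (Eventually.of_forall fun n => ?_)
      rw [h.sub_Y_eq h' (n := n) fun i _ => hc i]
      exact mul_le_of_le_one_right (freeProd_nonneg h.two_le n)
        (by linarith [(h.memY n).1, (h'.memY n).2])
    linarith
  have hmin : ∀ i < Nat.find hex, a i = a' i := fun i hi => not_not.1 (Nat.find_min hex hi)
  have hne := Nat.find_spec hex
  set n := Nat.find hex
  have hJ : n + 1 ∉ J := fun hJ => hne ((h.digit n hJ).trans (h'.digit n hJ).symm)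
  refine ⟨n, hJ, lt_of_not_ge fun hle => ?_, hmin⟩
  have hlt : a n + 1 ≤ a' n := lt_of_le_of_ne hle hne
  have ha : (2 : ℝ) ≤ a n := by exact_mod_cast h.two_le n
  have ha' : (a n : ℝ) + 1 ≤ a' n := by exact_mod_cast hlt
  have hsub := h.sub_Y_eq h' hmin
  have h1 : 1 / (a n : ℝ) ≤ Y n := by
    rw [h.stepY n hJ, lurothBranch_eq]
    exact le_add_of_nonneg_right (mul_nonneg (lurothRatio_pos (h.two_le n)).le (h.memY _).1.le)
  have h2 : Y' n ≤ 1 / (a' n - 1) := by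
    have hr := mul_le_of_le_one_right (lurothRatio_pos (h'.two_le n)).le (h'.memY (n + 1)).2
    have e : 1 / (a' n : ℝ) + lurothRatio (a' n) = 1 / (a' n - 1) := by
      have : (a' n : ℝ) - 1 ≠ 0 := by linarith
      have : (a' n : ℝ) ≠ 0 := by linarith
      unfold lurothRatio
      field_simp
      ring
    rw [h'.stepY n hJ, lurothBranch_eq]
    linarith
  have h3 : 1 / ((a' n : ℝ) - 1) ≤ 1 / a n := one_div_le_one_div_of_le (by linarith) (by linarith)
  have := mul_nonpos_of_nonneg_of_nonpos (freeProd_nonneg (J := J) h.two_le n)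
    (show Y' n - Y n ≤ 0 by linarith)
  linarith

lemma sub_le_mul_rpow (h : LurothCoupling J d a X Y) (h' : LurothCoupling J d a' X' Y')
    (hM : 2 ≤ M) (hd : ∀ i, d i ≤ M) (hs0 : 0 < s) (hs1 : s < 1) (hC0 : 1 ≤ C)
    (hC : ∀ n, freeProd J a n ≤ C * (∏ i ∈ Finset.range n, lurothRatio (a i)) ^ s)
    (hC' : ∀ n, freeProd J a' n ≤ C * (∏ i ∈ Finset.range n, lurothRatio (a' i)) ^ s)
    (hY : Y 0 < Y' 0) : Y' 0 - Y 0 ≤ 3 * M * C * |X' 0 - X 0| ^ s := by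
  classical
  obtain ⟨n, hJ, hlt, haa⟩ := h.exists_first_ne h' hs0 hC hY
  have hM' : (2 : ℝ) ≤ M := by exact_mod_cast hM
  have hb : (2 : ℝ) ≤ a' n := by exact_mod_cast h'.two_le n
  have hab : (a' n : ℝ) + 1 ≤ a n := by exact_mod_cast (show a' n + 1 ≤ a n from hlt)
  have hX := h.sub_X_eq h' haa
  have hYe := h.sub_Y_eq h' haa
  have hXa := h.freeProd_mul_one_sub_le hs0 hs1 hC0 hC (n + 1)
  have hpq : ∀ i ∈ Finset.range n, a' i = a i := fun i hi => (haa i (Finset.mem_range.1 hi)).symm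
  have eq' : ∏ i ∈ Finset.range n, lurothRatio (a' i) = ∏ i ∈ Finset.range n, lurothRatio (a i) :=
    Finset.prod_congr rfl fun i hi => by rw [hpq i hi]
  have ep' : freeProd J a' n = freeProd J a n :=
    Finset.prod_congr rfl fun i hi => by rw [hpq i hi]
  have ep : ∀ b : ℕ → ℕ, freeProd J b (n + 1) = freeProd J b n * lurothRatio (b n) := fun b => by
    rw [freeProd, Finset.prod_range_succ, if_neg hJ, freeProd]
  have hC1 := hC' (n + 1)
  rw [ep, ep', Finset.prod_range_succ, eq'] at hC1
  rw [ep, Finset.prod_range_succ] at hXa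
  have hCn := hC n
  have hp0 : 0 ≤ freeProd J a n := freeProd_nonneg h.two_le n
  have hq0 := prod_lurothRatio_pos h.two_le n
  have hr := lurothRatio_pos (h.two_le n)
  have hr' := lurothRatio_pos (h'.two_le n)
  have hYX := h'.Y_le_mul_X hM hd (n + 1)
  set p := freeProd J a n
  set q := ∏ i ∈ Finset.range n, lurothRatio (a i)
  set r := lurothRatio (a n) with hrdef
  set r' := lurothRatio (a' n)
  obtain ⟨x0, x1⟩ := h.memX (n + 1)
  obtain ⟨x0', x1'⟩ := h'.memX (n + 1)
  obtain ⟨y0', y1'⟩ := h'.memY (n + 1)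
  set g : ℝ := 1 / a' n - 1 / (a n - 1) with hg
  have g0 : 0 ≤ g := sub_nonneg.2 (one_div_le_one_div_of_le (by linarith) (by linarith))
  have g1 : g ≤ 1 := by
    have h1 : 1 / (a' n : ℝ) ≤ 1 := by rw [div_le_one (by linarith)]; linarith
    have h2 : 0 ≤ 1 / ((a n : ℝ) - 1) := one_div_nonneg.2 (by linarith)
    linarith
  have er : 1 / (a n : ℝ) = 1 / (a n - 1) - r := by
    have : (a n : ℝ) - 1 ≠ 0 := by linarith
    have : (a n : ℝ) ≠ 0 := by linarith
    rw [hrdef, lurothRatio]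
    field_simp
  have decX : X' 0 - X 0 = q * r' * X' (n + 1) + q * g + q * r * (1 - X (n + 1)) := by
    rw [hX, h.stepX n, h'.stepX n, lurothBranch_eq, lurothBranch_eq, er, hg]; ring
  have decY : Y' 0 - Y 0 = p * r' * Y' (n + 1) + p * g + p * r * (1 - Y (n + 1)) := by
    rw [hYe, h.stepY n hJ, h'.stepY n hJ, lurothBranch_eq, lurothBranch_eq, er, hg]; ring
  have A1 : 0 ≤ q * r' * X' (n + 1) := by positivity
  have A2 : 0 ≤ q * g := by positivity
  have A3 : 0 ≤ q * r * (1 - X (n + 1)) := mul_nonneg (by positivity) (by linarith)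
  have le_rpow : ∀ t : ℝ, 0 ≤ t → t ≤ 1 → t ≤ t ^ s := fun t t0 t1 => by
    rcases t0.eq_or_lt with rfl | t0
    · rw [Real.zero_rpow hs0.ne']
    · simpa using Real.rpow_le_rpow_of_exponent_ge t0 t1 hs1.le
  have B1 : p * r' * Y' (n + 1) ≤ M * C * (q * r' * X' (n + 1)) ^ s := by
    rw [Real.mul_rpow (by positivity) x0'.le]
    calc p * r' * Y' (n + 1) ≤ C * (q * r') ^ s * (M * X' (n + 1) ^ s) :=
          mul_le_mul hC1 (hYX.trans (by gcongr; exact le_rpow _ x0'.le x1')) y0'.le (by positivity)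
      _ = _ := by ring
  have B2 : p * g ≤ M * C * (q * g) ^ s := by
    rw [Real.mul_rpow hq0.le g0]
    calc p * g ≤ C * q ^ s * g ^ s := mul_le_mul hCn (le_rpow g g0 g1) g0 (by positivity)
      _ ≤ M * (C * q ^ s * g ^ s) := le_mul_of_one_le_left (by positivity) (by linarith)
      _ = _ := by ring
  have B3 : p * r * (1 - Y (n + 1)) ≤ M * C * (q * r * (1 - X (n + 1))) ^ s :=
    hXa.trans (by gcongr)
  have mono : ∀ t, 0 ≤ t → t ≤ X' 0 - X 0 → M * C * t ^ s ≤ M * C * |X' 0 - X 0| ^ s :=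
    fun t t0 ht => by gcongr; exact ht.trans (le_abs_self _)
  have E1 := B1.trans (mono _ A1 (by linarith))
  have E2 := B2.trans (mono _ A2 (by linarith))
  have E3 := B3.trans (mono _ A3 (by linarith))
  linarith

end LurothCoupling

open scoped NNReal ENNReal in
/-- A map with a Hölder inverse does not decrease dimension by more than the Hölder exponent. -/
lemma mul_dimH_le_of_abs_sub_le {g : ℝ → ℝ} {A : Set ℝ} {K : ℝ} {s : ℝ≥0} (hs : 0 < s)
    (hK : 0 ≤ K) (h : ∀ y ∈ A, ∀ y' ∈ A, y < y' → y' - y ≤ K * |g y' - g y| ^ (s : ℝ)) :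
    s * dimH A ≤ dimH (g '' A) := by
  have habs : ∀ y ∈ A, ∀ y' ∈ A, |y - y'| ≤ K * |g y - g y'| ^ (s : ℝ) := by
    intro y hy y' hy'
    rcases lt_trichotomy y y' with hlt | rfl | hlt
    · rw [abs_sub_comm y, abs_sub_comm (g y), abs_of_pos (sub_pos.2 hlt)]
      exact h y hy y' hy' hlt
    · simpa using mul_nonneg hK (Real.rpow_nonneg le_rfl (s : ℝ))
    · rw [abs_of_pos (sub_pos.2 hlt)]
      exact h y' hy' y hy hlt
  have hinj : InjOn g A := by
    intro y hy y' hy' e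
    have := habs y hy y' hy'
    rw [e, sub_self, abs_zero, Real.zero_rpow (by exact_mod_cast hs.ne'), mul_zero] at this
    exact sub_eq_zero.1 (abs_nonpos_iff.1 this)
  have hleft := hinj.leftInvOn_invFunOn
  have hH : HolderOnWith K.toNNReal s (Function.invFunOn g A) (g '' A) := by
    rintro _ ⟨y, hy, rfl⟩ _ ⟨y', hy', rfl⟩
    rw [hleft hy, hleft hy', edist_dist, edist_dist, Real.dist_eq, Real.dist_eq,
      ENNReal.ofReal_rpow_of_nonneg (abs_nonneg _) s.coe_nonneg]
    change _ ≤ ENNReal.ofReal K * _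
    rw [← ENNReal.ofReal_mul hK]
    exact ENNReal.ofReal_le_ofReal (habs y hy y' hy')
  have := hH.dimH_image_le hs
  rw [hleft.image_image] at this
  rwa [ENNReal.le_div_iff_mul_le (Or.inl (by exact_mod_cast hs.ne')) (Or.inl ENNReal.coe_ne_top),
    mul_comm] at this

/-- If 𝒥 is an infinite set of positive integers of density zero and (dᵢ) is a sequence of
    integers with 2 ≤ dᵢ ≤ M, then {x ∈ (0,1] : dᵢ(x) = dᵢ for all i ∈ 𝒥} has Hausdorff
    dimension 1. -/
theorem luroth_sparse_prescription_dimH (J : Set ℕ) (hJinf : J.Infinite)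
    (hJpos : ∀ j ∈ J, 1 ≤ j)
    (hdens : Filter.Tendsto (fun n : ℕ => ((J ∩ Set.Icc 1 n).ncard : ℝ) / n)
      Filter.atTop (nhds 0))
    (M : ℕ) (hM : 2 ≤ M) (d : ℕ → ℕ) (hd : ∀ i : ℕ, 2 ≤ d i ∧ d i ≤ M) :
    dimH {x : ℝ | x ∈ Set.Ioc (0:ℝ) 1 ∧ ∀ i ∈ J, lurothD i x = d i} = 1 := by
  refine le_antisymm ((dimH_mono (subset_univ _)).trans Real.dimH_univ.le) ?_
  refine ENNReal.le_of_forall_nnreal_lt fun s hs => ?_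
  rcases eq_or_ne s 0 with rfl | hs0
  · simp
  have hs0 : 0 < s := pos_iff_ne_zero.2 hs0
  have hs1 : (s : ℝ) < 1 := by exact_mod_cast hs
  obtain ⟨C, hC1, hC⟩ := exists_freeProd_le_rpow hdens (one_le_two.trans hM) hs1
  have hdim : dimH (Ioc (0 : ℝ) 1) = 1 := by
    simpa using Real.dimH_of_nonempty_interior (s := Ioc (0 : ℝ) 1) (by simp)
  have hcoup := fun (y : ℝ) (hy : y ∈ Ioc (0 : ℝ) 1) =>
    lurothCoupling_insertDigits J (fun i => (hd i).1) hy
  have hM' : ∀ y ∈ Ioc (0 : ℝ) 1, ∀ n, n + 1 ∈ J → insertDigits J d y n ≤ M := fun y hy n hn =>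
    ((hcoup y hy).digit n hn).trans_le (hd _).2
  have hle := mul_dimH_le_of_abs_sub_le (g := fun y => lurothSeries (insertDigits J d y))
    (A := Ioc (0 : ℝ) 1) (K := 3 * M * C) hs0 (by positivity) fun y hy y' hy' hlt =>
      (hcoup y hy).sub_le_mul_rpow (hcoup y' hy') hM (fun i => (hd i).2) (by exact_mod_cast hs0)
        hs1 hC1 (hC _ (hcoup y hy).two_le (hM' y hy)) (hC _ (hcoup y' hy').two_le (hM' y' hy')) hlt
  rw [hdim, mul_one] at hle
  refine hle.trans (dimH_mono ?_)
  rintro _ ⟨y, hy, rfl⟩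
  refine ⟨lurothSeries_mem (hcoup y hy).two_le, fun i hi => ?_⟩
  obtain ⟨n, rfl⟩ := Nat.exists_eq_add_of_le' (hJpos i hi)
  rw [lurothD_lurothSeries (hcoup y hy).two_le, (hcoup y hy).digit n hi]
end
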